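/- For all n ≥ 2 and k ≥ 2, there is no cyclic sequence s_1s_2⋯s_m of length m = C(n+k−1, k) over the nonnegative integers (indices taken modulo m) such that the m cyclic windows s_i s_{i+1}⋯s_{i+n−1} of length n are pairwise distinct and form exactly the set of all strings f_1f_2⋯f_n of nonnegative integers with f_1 + f_2 + ⋯ + f_n = k. That is, universal cycles for the k-multisets of [n] using the full frequency-map representation do not exist for n, k ≥ 2. -/

import Mathlib

/-- The cyclic window of length `n` of `u` starting at position `i` (0-based). -/
def cycWindow (u : List ℕ) (n i : ℕ) : List ℕ :=
  (List.range n).map fun j => u.getD ((i + j) % u.length) 0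

/-- If all length-`n` windows of `a` have the same sum, then `a` has period `n`. -/
theorem periodic_of_sum_window_const {a : ℕ → ℕ} {n k : ℕ}
    (h : ∀ i, ∑ j ∈ Finset.range n, a (i + j) = k) : Function.Periodic a n := by
  intro i
  have h₀ := Finset.sum_range_succ (fun j => a (i + j)) n
  have h₁ := Finset.sum_range_succ' (fun j => a (i + j)) n
  have h₂ := h (i + 1)
  simp only [Nat.add_right_comm i 1, Nat.add_assoc] at h₂
  rw [h i] at h₀
  rw [h₂, add_zero] at h₁
  omega

/-- Each value of an `n`-periodic sequence occurs in every window of length `n`. -/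
theorem Function.Periodic.exists_lt_eq {a : ℕ → ℕ} {n : ℕ} (h : Function.Periodic a n)
    (hn : 0 < n) (i i' : ℕ) : ∃ j < n, a (i' + j) = a i := by
  refine ⟨(i + n * i' - i') % n, Nat.mod_lt _ hn, ?_⟩
  have hle : i' ≤ n * i' := Nat.le_mul_of_pos_left i' hn
  have hmod : (i' + (i + n * i' - i') % n) % n = i % n := by
    rw [Nat.add_mod_mod, Nat.add_sub_cancel' (by omega), Nat.add_mul_mod_self_left]
  rw [← h.map_mod_nat, hmod, h.map_mod_nat]

theorem cycWindow_mod (u : List ℕ) (n i : ℕ) : cycWindow u n (i % u.length) = cycWindow u n i := by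
  simp [cycWindow]

theorem sum_cycWindow (u : List ℕ) (n i : ℕ) :
    (cycWindow u n i).sum = ∑ j ∈ Finset.range n, u.getD ((i + j) % u.length) 0 := rfl

/-- For all `n ≥ 2` and `k ≥ 2`, there is no cyclic sequence
`s_1⋯s_m` of length `m = C(n+k−1, k)` over the nonnegative integers whose `m`
cyclic windows of length `n` are pairwise distinct and form exactly the set of
all strings `f_1⋯f_n` of nonnegative integers with `f_1+⋯+f_n = k`.  That is,
universal cycles for the `k`-multisets of `[n]` using the full frequency-map
representation do not exist for `n, k ≥ 2`. -/
theorem stmt18 (n k : ℕ) (hn : 2 ≤ n) (hk : 2 ≤ k) :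
    ¬ ∃ s : List ℕ, s.length = Nat.choose (n + k - 1) k ∧
      (∀ i < s.length, ∀ j < s.length, cycWindow s n i = cycWindow s n j → i = j) ∧
      (∀ f : List ℕ, (f.length = n ∧ f.sum = k) ↔
        ∃ i < s.length, cycWindow s n i = f) := by
  rintro ⟨s, hlen, -, hs⟩
  have hpos : 0 < s.length := hlen ▸ Nat.choose_pos (by omega)
  have hper : Function.Periodic (fun i => s.getD (i % s.length) 0) n :=
    periodic_of_sum_window_const (k := k) fun i => by
      rw [← sum_cycWindow, ← cycWindow_mod]
      exact ((hs _).2 ⟨_, Nat.mod_lt i hpos, rfl⟩).2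
  obtain ⟨i, -, hi⟩ := (hs (k :: List.replicate (n - 1) 0)).1
    ⟨by simp; omega, by simp⟩
  obtain ⟨i', -, hi'⟩ := (hs ((k - 1) :: 1 :: List.replicate (n - 2) 0)).1
    ⟨by simp; omega, by simp; omega⟩
  have hk_mem : k ∈ cycWindow s n i := by simp [hi]
  obtain ⟨j, -, hj⟩ := List.mem_map.1 hk_mem
  obtain ⟨j', hj'n, hj'⟩ := hper.exists_lt_eq (by omega) (i + j) i'
  have hk_mem' : k ∈ cycWindow s n i' :=
    List.mem_map.2 ⟨j', List.mem_range.2 hj'n, hj'.trans hj⟩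
  simp only [hi', List.mem_cons, List.mem_replicate] at hk_mem'
  omega
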